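/- arXiv:2304.04322 — 4 statements merged into one kernel-verified Lean document; each statement's English description precedes it below -/
import Mathlib

section
/- Let G be a group, let (A_n)_{n∈ℕ} be a right Følner sequence in G, and let A ⊆ G be zero-measured. Then |A_n ∩ A| / |A_n| → 0 as n → ∞ (with cardinalities of the finite sets A_n and A_n ∩ A taken in ℝ). -/
open scoped symmDiff

/-- A finitely additive right-invariant probability measure on a group `G`. -/
def IsRightInvariantMeasure {G : Type*} [Group G] (μ : Set G → ℝ) : Prop :=
  (∀ A : Set G, 0 ≤ μ A) ∧
  (∀ A B : Set G, Disjoint A B → μ (A ∪ B) = μ A + μ B) ∧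
  (∀ (A : Set G) (g : G), μ ((· * g) '' A) = μ A) ∧
  μ Set.univ = 1

/-- A subset is zero-measured if every finitely additive right-invariant
probability measure gives it measure `0`. -/
def ZeroMeasured {G : Type*} [Group G] (A : Set G) : Prop :=
  ∀ μ : Set G → ℝ, IsRightInvariantMeasure μ → μ A = 0

/-- A right Følner sequence: a sequence of nonempty finite subsets that is almost
invariant under right translations. -/
def IsRightFolnerSeq {G : Type*} [Group G] (A : ℕ → Finset G) : Prop :=
  (∀ n, (A n).Nonempty) ∧
  ∀ g : G, Filter.Tendsto
    (fun n => (((((· * g) '' (A n : Set G)) ∆ (A n : Set G)).ncard : ℝ) / ((A n).card : ℝ)))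
    Filter.atTop (nhds 0)

lemma ncard_aux {G : Type*} (S T C : Set G) (hS : S.Finite) (hT : T.Finite) :
    ((S ∩ C).ncard : ℝ) ≤ (T ∩ C).ncard + (S ∆ T).ncard := by
  have hfin : (S ∆ T).Finite :=
    (hS.union hT).subset (fun x hx => by
      rcases hx with h | h
      · exact Or.inl h.1
      · exact Or.inr h.1)
  have h1 : S ∩ C ⊆ (T ∩ C) ∪ (S ∆ T) := by
    intro x hx
    by_cases h : x ∈ T
    · exact Or.inl ⟨h, hx.2⟩
    · exact Or.inr (Or.inl ⟨hx.1, h⟩)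
  have h2 := Set.ncard_le_ncard h1 ((hT.inter_of_left C).union hfin)
  have h3 := Set.ncard_union_le (T ∩ C) (S ∆ T)
  exact_mod_cast h2.trans h3

/-- if `(A_n)` is a right Følner sequence and `A` is zero-measured, then
`|A_n ∩ A| / |A_n| → 0`. -/
theorem statement1 {G : Type*} [Group G] (A : ℕ → Finset G) (hA : IsRightFolnerSeq A)
    (Z : Set G) (hZ : ZeroMeasured Z) :
    Filter.Tendsto (fun n => ((((A n : Set G) ∩ Z).ncard : ℝ) / ((A n).card : ℝ)))
      Filter.atTop (nhds 0) := by
  classical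
  obtain ⟨hne, hF⟩ := hA
  have hpos : ∀ n, (0 : ℝ) < (A n).card := fun n => by
    exact_mod_cast (hne n).card_pos
  rw [Filter.tendsto_iff_ultrafilter]
  intro U hU
  have hU' : (U : Filter ℕ) ≤ Filter.atTop := hU
  have hex : ∀ B : Set G, ∃ x : ℝ, Filter.Tendsto
      (fun n => ((((A n : Set G) ∩ B).ncard : ℝ) / ((A n).card : ℝ))) U (nhds x) := by
    intro B
    have hc : IsCompact (Set.Icc (0 : ℝ) 1) := isCompact_Icc
    obtain ⟨x, -, hx⟩ := hc.ultrafilter_le_nhds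
      (U.map (fun n => ((((A n : Set G) ∩ B).ncard : ℝ) / ((A n).card : ℝ)))) (by
        rw [Filter.le_principal_iff]
        refine Filter.mem_map.2 (Filter.univ_mem' ?_)
        intro n
        refine ⟨by positivity, ?_⟩
        rw [div_le_one (hpos n)]
        have := Set.ncard_le_ncard (Set.inter_subset_left (s := (A n : Set G)) (t := B))
          (A n).finite_toSet
        rw [Set.ncard_coe_finset] at this
        exact_mod_cast this)
    exact ⟨x, hx⟩
  choose μ hμ using hex
  have hinv : IsRightInvariantMeasure μ := by
    refine ⟨?_, ?_, ?_, ?_⟩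
    · intro B
      exact ge_of_tendsto' (hμ B) (fun n => by positivity)
    · intro B C hBC
      refine tendsto_nhds_unique (hμ (B ∪ C)) (((hμ B).add (hμ C)).congr ?_)
      intro n
      rw [← add_div, Set.inter_union_distrib_left, Set.ncard_union_eq
        (hBC.mono Set.inter_subset_right Set.inter_subset_right)
        ((A n).finite_toSet.inter_of_left B) ((A n).finite_toSet.inter_of_left C)]
      push_cast
      rfl
    · intro B g
      have h0 := (hF g).mono_left hU'
      have hz := (hμ ((· * g) '' B)).sub (hμ B)
      have hlim := squeeze_zero_norm (f := fun n =>
        ((((A n : Set G) ∩ ((· * g) '' B)).ncard : ℝ) / ((A n).card : ℝ)) -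
          ((((A n : Set G) ∩ B).ncard : ℝ) / ((A n).card : ℝ))) (fun n => by
        have e : ((A n : Set G) ∩ B).ncard
            = (((· * g) '' (A n : Set G)) ∩ ((· * g) '' B)).ncard := by
          rw [← Set.image_inter (mul_left_injective g),
            Set.ncard_image_of_injective _ (mul_left_injective g)]
        have i1 := ncard_aux ((· * g) '' (A n : Set G)) (A n : Set G) ((· * g) '' B)
          ((A n).finite_toSet.image _) (A n).finite_toSet
        have i2 := ncard_aux (A n : Set G) ((· * g) '' (A n : Set G)) ((· * g) '' B)
          (A n).finite_toSet ((A n).finite_toSet.image _)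
        rw [symmDiff_comm] at i2
        rw [← sub_div, Real.norm_eq_abs, abs_div, abs_of_pos (hpos n)]
        refine div_le_div_of_nonneg_right ?_ (hpos n).le
        rw [e, abs_le]
        constructor <;> linarith) h0
      exact sub_eq_zero.1 (tendsto_nhds_unique hz hlim)
    · refine tendsto_nhds_unique (hμ Set.univ) (tendsto_const_nhds.congr ?_)
      intro n
      rw [Set.inter_univ, Set.ncard_coe_finset, div_self (hpos n).ne']
  have := hμ Z
  rwa [hZ μ hinv] at this
end

section
/- Let G be a group, let (A_n)_{n∈ℕ} be a right Følner sequence in G, and let A ⊆ G be zero-measured. Set B_n = A_n \ A. Then there exists N ∈ ℕ such that B_n is nonempty for all n ≥ N, and for every g ∈ G one has |(B_n • g) ∆ B_n| / |B_n| → 0 as n → ∞. (That is, removing the elements of a zero-measured set from the members of a Følner sequence yields again a Følner sequence.) -/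
open scoped symmDiff

open Filter Topology in
lemma density_tendsto_zero {G : Type*} [Group G] (A : ℕ → Finset G) (hA : IsRightFolnerSeq A)
    (Z : Set G) (hZ : ZeroMeasured Z) :
    Tendsto (fun n => (((A n : Set G) ∩ Z).ncard : ℝ) / ((A n).card : ℝ)) atTop (𝓝 0) := by
  rw [tendsto_iff_ultrafilter]
  intro U hU
  have hpos : ∀ n, (0 : ℝ) < (A n).card := fun n => by
    exact_mod_cast (hA.1 n).card_pos
  have hlim : ∀ S : Set G, ∃ x : ℝ,
      Tendsto (fun n => (((A n : Set G) ∩ S).ncard : ℝ) / ((A n).card : ℝ)) U (𝓝 x) := by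
    intro S
    have hc : IsCompact (Set.Icc (0 : ℝ) 1) := isCompact_Icc
    obtain ⟨x, -, hx⟩ := hc.ultrafilter_le_nhds
      (U.map (fun n => (((A n : Set G) ∩ S).ncard : ℝ) / ((A n).card : ℝ))) (by
        rw [Filter.le_principal_iff]
        refine Filter.mem_map.2 (Filter.univ_mem' fun n => ?_)
        refine ⟨by positivity, ?_⟩
        rw [div_le_one (hpos n)]
        have := Set.ncard_le_ncard (Set.inter_subset_left : (A n : Set G) ∩ S ⊆ A n)
          (A n).finite_toSet
        rw [Set.ncard_coe_finset] at this
        exact_mod_cast this)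
    exact ⟨x, hx⟩
  choose μ hμ using hlim
  have key : IsRightInvariantMeasure μ := by
    refine ⟨fun S => ?_, fun S T hST => ?_, fun S g => ?_, ?_⟩
    · exact ge_of_tendsto' (hμ S) fun n => by positivity
    · refine tendsto_nhds_unique (hμ (S ∪ T)) (((hμ S).add (hμ T)).congr fun n => ?_)
      rw [Set.inter_union_distrib_left, Set.ncard_union_eq
        (hST.mono Set.inter_subset_right Set.inter_subset_right)
        ((A n).finite_toSet.inter_of_left _) ((A n).finite_toSet.inter_of_left _)]
      push_cast
      ring
    · have hd := ((hμ ((· * g) '' S)).sub (hμ S))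
      have h0 := (hA.2 g).mono_left hU
      have : Tendsto (fun n => (((A n : Set G) ∩ ((· * g) '' S)).ncard : ℝ) / ((A n).card : ℝ)
          - (((A n : Set G) ∩ S).ncard : ℝ) / ((A n).card : ℝ)) U (𝓝 0) := by
        refine squeeze_zero_norm (fun n => ?_) h0
        rw [← sub_div, Real.norm_eq_abs, abs_div, abs_of_pos (hpos n)]
        refine div_le_div_of_nonneg_right ?_ (hpos n).le
        have hinj : Function.Injective (· * g : G → G) := mul_left_injective g
        have e : ((A n : Set G) ∩ S).ncard =
            (((· * g) '' (A n : Set G)) ∩ ((· * g) '' S)).ncard := by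
          rw [← Set.image_inter hinj, Set.ncard_image_of_injective _ hinj]
        have fA := (A n).finite_toSet
        have fB := fA.image (· * g)
        have fD := fB.symmDiff fA
        rw [e]
        have h1 : ((A n : Set G) ∩ ((· * g) '' S)).ncard ≤
            (((· * g) '' (A n : Set G)) ∩ ((· * g) '' S)).ncard
              + (((· * g) '' (A n : Set G)) ∆ (A n : Set G)).ncard := by
          refine (Set.ncard_le_ncard ?_ ((fB.inter_of_left _).union fD)).trans
            (Set.ncard_union_le _ _)
          generalize (· * g) '' (A n : Set G) = X
          generalize (· * g) '' S = Y
          intro x hx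
          simp only [Set.mem_union, Set.mem_inter_iff, Set.mem_symmDiff] at hx ⊢
          tauto
        have h2 : (((· * g) '' (A n : Set G)) ∩ ((· * g) '' S)).ncard ≤
            ((A n : Set G) ∩ ((· * g) '' S)).ncard
              + (((· * g) '' (A n : Set G)) ∆ (A n : Set G)).ncard := by
          refine (Set.ncard_le_ncard ?_ ((fA.inter_of_left _).union fD)).trans
            (Set.ncard_union_le _ _)
          generalize (· * g) '' (A n : Set G) = X
          generalize (· * g) '' S = Y
          intro x hx
          simp only [Set.mem_union, Set.mem_inter_iff, Set.mem_symmDiff] at hx ⊢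
          tauto
        rify at h1 h2
        rw [abs_le]
        constructor <;> linarith
      exact sub_eq_zero.1 (tendsto_nhds_unique hd this)
    · refine tendsto_nhds_unique (hμ Set.univ) (tendsto_const_nhds.congr fun n => ?_)
      rw [Set.inter_univ, Set.ncard_coe_finset, div_self (hpos n).ne']
  rw [← hZ μ key]
  exact hμ Z

/-- removing the elements of a zero-measured set `Z` from the members of a
right Følner sequence `A_n` yields sets `B_n = A_n \ Z` which are eventually nonempty and
again almost invariant under every right translation. -/
theorem statement2 {G : Type*} [Group G] (A : ℕ → Finset G) (hA : IsRightFolnerSeq A)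
    (Z : Set G) (hZ : ZeroMeasured Z) (B : ℕ → Set G) (hB : ∀ n, B n = (A n : Set G) \ Z) :
    (∃ N : ℕ, ∀ n ≥ N, (B n).Nonempty) ∧
    ∀ g : G, Filter.Tendsto
      (fun n => (((((· * g) '' B n) ∆ (B n)).ncard : ℝ) / ((B n).ncard : ℝ)))
      Filter.atTop (nhds 0) := by
  have hd := density_tendsto_zero A hA Z hZ
  have hpos : ∀ n, (0 : ℝ) < (A n).card := fun n => by
    exact_mod_cast (hA.1 n).card_pos
  have hcard : ∀ n, ((B n).ncard : ℝ) =
      (A n).card * (1 - (((A n : Set G) ∩ Z).ncard : ℝ) / ((A n).card : ℝ)) := by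
    intro n
    have h := Set.ncard_inter_add_ncard_diff_eq_ncard (A n : Set G) Z (A n).finite_toSet
    rw [← hB, Set.ncard_coe_finset] at h
    have := (hpos n).ne'
    rify at h
    field_simp
    linarith
  have hev := hd.eventually (gt_mem_nhds (zero_lt_one))
  constructor
  · obtain ⟨N, hN⟩ := Filter.eventually_atTop.1 hev
    refine ⟨N, fun n hn => ?_⟩
    apply Set.nonempty_of_ncard_ne_zero
    have h : (0 : ℝ) < (B n).ncard := by
      rw [hcard]
      exact mul_pos (hpos n) (by linarith [hN n hn])
    exact_mod_cast h.ne'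
  · intro g
    have hlim := ((hA.2 g).add (hd.const_mul 2)).div (hd.const_sub 1) (by norm_num)
    simp only [mul_zero, add_zero, zero_div] at hlim
    refine squeeze_zero' (Filter.Eventually.of_forall fun n => by positivity) ?_ hlim
    filter_upwards [hev] with n hn
    have hp := hpos n
    have hinj : Function.Injective (· * g : G → G) := mul_left_injective g
    have fA := (A n).finite_toSet
    have fZ := fA.inter_of_left Z
    have fD := (fA.image (· * g)).symmDiff fA
    have h1 : (((· * g) '' B n) ∆ (B n)).ncard ≤
        (((· * g) '' (A n : Set G)) ∆ (A n : Set G)).ncard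
          + ((A n : Set G) ∩ Z).ncard + ((A n : Set G) ∩ Z).ncard := by
      nth_rewrite 4 [← Set.ncard_image_of_injective _ hinj]
      refine (Set.ncard_le_ncard ?_ ((fD.union fZ).union (fZ.image (· * g)))).trans
        ((Set.ncard_union_le _ _).trans (Nat.add_le_add_right (Set.ncard_union_le _ _) _))
      rw [hB, Set.image_diff hinj, Set.image_inter hinj]
      generalize (· * g) '' (A n : Set G) = X
      generalize (· * g) '' Z = Y
      intro x hx
      simp only [Set.mem_union, Set.mem_inter_iff, Set.mem_symmDiff, Set.mem_diff] at hx ⊢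
      tauto
    rify at h1
    simp only [Pi.div_apply]
    rw [hcard, ← div_div]
    refine div_le_div_of_nonneg_right ?_ (by linarith)
    rw [← mul_div_assoc, ← add_div]
    exact div_le_div_of_nonneg_right (by linarith) hp.le
end

section
/- Let G be a group, let (A_n)_{n∈ℕ} be a right Følner sequence in G, and let U be a free (non-principal) ultrafilter on ℕ. Then there exists a finitely additive right-invariant probability measure μ on G such that for every Z ⊆ G, the sequence |A_n ∩ Z| / |A_n| converges to μ(Z) along the filter U. In particular, a group admitting a right Følner sequence admits a finitely additive right-invariant probability measure. -/
open scoped symmDiff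

/-- given a right Følner sequence `(A_n)` in `G` and a free (non-principal)
ultrafilter `U` on `ℕ`, there is a finitely additive right-invariant probability measure
`μ` on `G` such that for every `Z ⊆ G` the sequence `|A_n ∩ Z| / |A_n|` converges to
`μ Z` along `U`. -/
theorem statement3 {G : Type*} [Group G] (A : ℕ → Finset G) (hA : IsRightFolnerSeq A)
    (U : Ultrafilter ℕ) (hU : (U : Filter ℕ) ≤ Filter.cofinite) :
    ∃ μ : Set G → ℝ, IsRightInvariantMeasure μ ∧
      ∀ Z : Set G, Filter.Tendsto
        (fun n => ((((A n : Set G) ∩ Z).ncard : ℝ) / ((A n).card : ℝ)))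
        (U : Filter ℕ) (nhds (μ Z)) := by
  classical
  obtain ⟨hne, hF⟩ := hA
  have hpos : ∀ n, (0 : ℝ) < ((A n).card : ℝ) := fun n => by
    exact_mod_cast (hne n).card_pos
  have hfin : ∀ n, (A n : Set G).Finite := fun n => (A n).finite_toSet
  have hex : ∀ Z : Set G, ∃ x : ℝ, Filter.Tendsto
      (fun n => ((((A n : Set G) ∩ Z).ncard : ℝ) / ((A n).card : ℝ)))
      (U : Filter ℕ) (nhds x) := by
    intro Z
    have hmem : ∀ n, ((((A n : Set G) ∩ Z).ncard : ℝ) / ((A n).card : ℝ)) ∈ Set.Icc (0 : ℝ) 1 := by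
      intro n
      refine ⟨by positivity, ?_⟩
      rw [div_le_one (hpos n)]
      have h := Set.ncard_le_ncard (Set.inter_subset_left (s := (A n : Set G)) (t := Z)) (hfin n)
      rw [Set.ncard_coe_finset] at h
      exact_mod_cast h
    obtain ⟨x, -, hx⟩ := (isCompact_Icc (a := (0 : ℝ)) (b := 1)).ultrafilter_le_nhds
      (U.map (fun n => ((((A n : Set G) ∩ Z).ncard : ℝ) / ((A n).card : ℝ))))
      (by
        rw [Filter.le_principal_iff]
        exact Filter.mem_map.mpr (Filter.univ_mem' hmem))
    exact ⟨x, hx⟩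
  choose μ hμ using hex
  refine ⟨μ, ⟨?_, ?_, ?_, ?_⟩, hμ⟩
  · intro Z
    exact ge_of_tendsto' (hμ Z) (fun n => by positivity)
  · intro B C hBC
    refine tendsto_nhds_unique (hμ (B ∪ C)) (((hμ B).add (hμ C)).congr ?_)
    intro n
    rw [← add_div, Set.inter_union_distrib_left, Set.ncard_union_eq
      (hBC.mono Set.inter_subset_right Set.inter_subset_right)
      ((hfin n).subset Set.inter_subset_left) ((hfin n).subset Set.inter_subset_left)]
    push_cast
    rfl
  · intro Z g
    have hU' : (U : Filter ℕ) ≤ Filter.atTop := by rwa [← Nat.cofinite_eq_atTop]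
    have h0 := (hF g).mono_left hU'
    have hd := (hμ ((· * g) '' Z)).sub (hμ Z)
    refine sub_eq_zero.mp (tendsto_nhds_unique hd (squeeze_zero_norm (fun n => ?_) h0))
    · rw [← sub_div, Real.norm_eq_abs, abs_div, abs_of_pos (hpos n)]
      refine div_le_div_of_nonneg_right ?_ (hpos n).le
      have hinj : Function.Injective (fun x : G => x * g) := mul_left_injective g
      have hS : (((· * g) '' (A n : Set G)) ∆ (A n : Set G)).Finite :=
        ((hfin n).image _).symmDiff (hfin n)
      have e : ((· * g) '' ((A n : Set G) ∩ Z)).ncard = ((A n : Set G) ∩ Z).ncard :=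
        Set.ncard_image_of_injective _ hinj
      rw [Set.image_inter hinj] at e
      have h1 : ((A n : Set G) ∩ ((· * g) '' Z)).ncard ≤
          (((· * g) '' (A n : Set G)) ∩ ((· * g) '' Z)).ncard +
          (((· * g) '' (A n : Set G)) ∆ (A n : Set G)).ncard := by
        refine (Set.ncard_le_ncard ?_ ((((hfin n).image _).inter_of_left _).union hS)).trans
          (Set.ncard_union_le _ _)
        intro x hx
        by_cases hxa : x ∈ (· * g) '' (A n : Set G)
        · exact Or.inl ⟨hxa, hx.2⟩
        · exact Or.inr (Or.inr ⟨hx.1, hxa⟩)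
      have h2 : (((· * g) '' (A n : Set G)) ∩ ((· * g) '' Z)).ncard ≤
          ((A n : Set G) ∩ ((· * g) '' Z)).ncard +
          (((· * g) '' (A n : Set G)) ∆ (A n : Set G)).ncard := by
        refine (Set.ncard_le_ncard ?_ (((hfin n).inter_of_left _).union hS)).trans
          (Set.ncard_union_le _ _)
        intro x hx
        by_cases hxa : x ∈ (A n : Set G)
        · exact Or.inl ⟨hxa, hx.2⟩
        · exact Or.inr (Or.inl ⟨hx.1, hxa⟩)
      rw [e] at h1 h2
      have h1' : (((A n : Set G) ∩ ((· * g) '' Z)).ncard : ℝ) ≤ (((A n : Set G) ∩ Z).ncard : ℝ) +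
          ((((· * g) '' (A n : Set G)) ∆ (A n : Set G)).ncard : ℝ) := by exact_mod_cast h1
      have h2' : (((A n : Set G) ∩ Z).ncard : ℝ) ≤ (((A n : Set G) ∩ ((· * g) '' Z)).ncard : ℝ) +
          ((((· * g) '' (A n : Set G)) ∆ (A n : Set G)).ncard : ℝ) := by exact_mod_cast h2
      rw [abs_le]
      constructor <;> linarith
  · refine tendsto_nhds_unique (hμ Set.univ) (tendsto_const_nhds.congr ?_)
    intro n
    rw [Set.inter_univ, Set.ncard_coe_finset, div_self (hpos n).ne']
end

section
/- Let G be a group, let g, h ∈ G, and let M₁, M₂, M₃, M₄, M₅, M₆, M₇ be pairwise disjoint subsets of G whose union is all of G. Assume: (i) (M₁ ∪ M₃ ∪ M₄ ∪ M₅) • g ⊆ M₃; (ii) (M₂ ∪ M₇) • h ⊆ M₇; (iii) M₇ • g⁻¹ ⊆ M₂; (iv) M₃ • h⁻¹ ⊆ M₄. Then for every finitely additive right-invariant probability measure μ on G one has μ(M₁) = μ(M₂) = μ(M₃) = μ(M₄) = μ(M₅) = μ(M₇) = 0 and μ(M₆) = 1. (Applied to Thompson's group F with g = x₀, h = x₁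 and the partition of F into the seven sets determined by the right divisors of canonical diagrams among {X₀, X₀⁻¹, X₁, X₁⁻¹}, this shows every such measure on F is concentrated on the set M₆ of elements whose canonical diagram has exactly X₀⁻¹ and X₁⁻¹ as such right divisors.) -/
/-- let `M₁, …, M₇` be pairwise disjoint subsets of `G` whose union is `G`,
and `g, h ∈ G` with `(M₁ ∪ M₃ ∪ M₄ ∪ M₅) • g ⊆ M₃`, `(M₂ ∪ M₇) • h ⊆ M₇`,
`M₇ • g⁻¹ ⊆ M₂` and `M₃ • h⁻¹ ⊆ M₄`. Then every finitely additive right-invariant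
probability measure `μ` on `G` satisfies
`μ M₁ = μ M₂ = μ M₃ = μ M₄ = μ M₅ = μ M₇ = 0` and `μ M₆ = 1`.
(For Thompson's group `F`, with `g = x₀`, `h = x₁` and the partition given by
right divisors of canonical diagrams, this concentrates every such measure on `M₆`.) -/
theorem statement8 {G : Type*} [Group G] (g h : G)
    (M₁ M₂ M₃ M₄ M₅ M₆ M₇ : Set G)
    (hdisj : List.Pairwise Disjoint [M₁, M₂, M₃, M₄, M₅, M₆, M₇])
    (hcover : M₁ ∪ M₂ ∪ M₃ ∪ M₄ ∪ M₅ ∪ M₆ ∪ M₇ = Set.univ)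
    (h1 : (· * g) '' (M₁ ∪ M₃ ∪ M₄ ∪ M₅) ⊆ M₃)
    (h2 : (· * h) '' (M₂ ∪ M₇) ⊆ M₇)
    (h3 : (· * g⁻¹) '' M₇ ⊆ M₂)
    (h4 : (· * h⁻¹) '' M₃ ⊆ M₄) :
    ∀ μ : Set G → ℝ, IsRightInvariantMeasure μ →
      μ M₁ = 0 ∧ μ M₂ = 0 ∧ μ M₃ = 0 ∧ μ M₄ = 0 ∧ μ M₅ = 0 ∧ μ M₇ = 0 ∧ μ M₆ = 1 := by
  rintro μ ⟨hpos, hadd, hinv, huniv⟩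
  have hmono : ∀ A B : Set G, A ⊆ B → μ A ≤ μ B := by
    intro A B hAB
    have e := hadd A (B \ A) Set.disjoint_sdiff_right
    rw [Set.union_diff_cancel hAB] at e
    linarith [hpos (B \ A)]
  simp only [List.pairwise_cons, List.mem_cons, List.not_mem_nil, or_false, forall_eq_or_imp,
    forall_eq] at hdisj
  obtain ⟨⟨d12, d13, d14, d15, d16, d17⟩, ⟨d23, d24, d25, d26, d27⟩, ⟨d34, d35, d36, d37⟩,
    ⟨d45, d46, d47⟩, ⟨d56, d57⟩, d67, -⟩ := hdisj
  have i1 := hmono _ _ h1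
  have i2 := hmono _ _ h2
  have i3 := hmono _ _ h3
  have i4 := hmono _ _ h4
  rw [hinv] at i1 i2 i3 i4
  rw [hadd _ _ (by simp [*]), hadd _ _ (by simp [*]), hadd _ _ d13] at i1
  rw [hadd _ _ d27] at i2
  rw [← hcover, hadd _ _ (by simp [*]), hadd _ _ (by simp [*]), hadd _ _ (by simp [*]),
    hadd _ _ (by simp [*]), hadd _ _ (by simp [*]), hadd _ _ d12] at huniv
  have p1 := hpos M₁
  have p2 := hpos M₂
  have p3 := hpos M₃
  have p4 := hpos M₄
  have p5 := hpos M₅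
  have p7 := hpos M₇
  refine ⟨?_, ?_, ?_, ?_, ?_, ?_, ?_⟩ <;> linarith
end
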